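/- Let X_1 and X_2 be independent random variables, uniformly distributed on [0,1/2] and on [1/2,1] respectively, and let Y_1 and Y_2 be independent [0,1]-valued random variables whose cumulative distribution functions satisfy (F_{Y_1}(x) + F_{Y_2}(x))/2 = x for all x ∈ [0,1]. Then E ∫_0^1 ((1_{Y_1 ≤ x} + 1_{Y_2 ≤ x})/2 − x)² dx ≥ E ∫_0^1 ((1_{X_1 ≤ x} + 1_{X_2 ≤ x})/2 − x)² dx, i.e. E L2²({Y_1,Y_2}) ≥ E L2²({X_1,X_2}). -/

import Mathlib

open MeasureTheory ProbabilityTheory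

noncomputable section

/-- Mean squared L2-discrepancy of the random two-point set `{W₁, W₂}` in `[0,1]`:
`E ∫₀¹ ((1_{W₁ ≤ x} + 1_{W₂ ≤ x})/2 − x)² dx`. -/
def meanL2sqPair {Ω : Type*} [MeasurableSpace Ω] (P : Measure Ω) (W₁ W₂ : Ω → ℝ) : ℝ :=
  ∫ ω, (∫ x in Set.Icc (0 : ℝ) 1,
      (((if W₁ ω ≤ x then (1 : ℝ) else 0) + (if W₂ ω ≤ x then (1 : ℝ) else 0)) / 2 - x) ^ 2)
    ∂P

/-- The second moment at `x` of the local discrepancy of two independent random points. -/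
lemma integral_sq_localDiscrepancy {Ω : Type*} [MeasurableSpace Ω]
    {P : Measure Ω} [IsProbabilityMeasure P] {W₁ W₂ : Ω → ℝ}
    (h₁ : Measurable W₁) (h₂ : Measurable W₂) (h : IndepFun W₁ W₂ P) (x : ℝ) :
    ∫ ω, (((if W₁ ω ≤ x then (1 : ℝ) else 0) + (if W₂ ω ≤ x then (1 : ℝ) else 0)) / 2 - x) ^ 2 ∂P =
      (P.real {ω | W₁ ω ≤ x} + P.real {ω | W₂ ω ≤ x}) * (1 / 4 - x)
        + P.real {ω | W₁ ω ≤ x} * P.real {ω | W₂ ω ≤ x} / 2 + x ^ 2 := by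
  have m₁ : MeasurableSet {ω | W₁ ω ≤ x} := measurableSet_le h₁ measurable_const
  have m₂ : MeasurableSet {ω | W₂ ω ≤ x} := measurableSet_le h₂ measurable_const
  have hprod : P.real ({ω | W₁ ω ≤ x} ∩ {ω | W₂ ω ≤ x}) =
      P.real {ω | W₁ ω ≤ x} * P.real {ω | W₂ ω ≤ x} := by
    have := h.measure_inter_preimage_eq_mul (Set.Iic x) (Set.Iic x)
      measurableSet_Iic measurableSet_Iic
    simp only [measureReal_def, ← ENNReal.toReal_mul]
    exact congrArg ENNReal.toReal this
  have i₁ : Integrable ({ω | W₁ ω ≤ x}.indicator (1 : Ω → ℝ)) P :=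
    (integrable_const (1 : ℝ)).indicator m₁
  have i₂ : Integrable ({ω | W₂ ω ≤ x}.indicator (1 : Ω → ℝ)) P :=
    (integrable_const (1 : ℝ)).indicator m₂
  have i₁₂ : Integrable (({ω | W₁ ω ≤ x} ∩ {ω | W₂ ω ≤ x}).indicator (1 : Ω → ℝ)) P :=
    (integrable_const (1 : ℝ)).indicator (m₁.inter m₂)
  have key : ∀ ω,
      (((if W₁ ω ≤ x then (1 : ℝ) else 0) + (if W₂ ω ≤ x then (1 : ℝ) else 0)) / 2 - x) ^ 2 =
      ({ω | W₁ ω ≤ x}.indicator (1 : Ω → ℝ) ω + {ω | W₂ ω ≤ x}.indicator (1 : Ω → ℝ) ω)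
          * (1 / 4 - x)
        + ({ω | W₁ ω ≤ x} ∩ {ω | W₂ ω ≤ x}).indicator (1 : Ω → ℝ) ω / 2 + x ^ 2 := by
    intro ω
    by_cases a : W₁ ω ≤ x <;> by_cases b : W₂ ω ≤ x <;> simp [Set.indicator, a, b] <;> ring
  have e₁ := (i₁.fun_add i₂).mul_const (1 / 4 - x)
  have e₂ := i₁₂.div_const 2
  simp_rw [key]
  rw [integral_add (e₁.fun_add e₂) (integrable_const _), integral_add e₁ e₂, integral_mul_const,
    integral_add i₁ i₂, integral_div, integral_indicator_one m₁, integral_indicator_one m₂,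
    integral_indicator_one (m₁.inter m₂), hprod]
  simp

/-- The squared local discrepancy is jointly integrable on `Ω × [0,1]`. -/
lemma integrable_sq_localDiscrepancy {Ω : Type*} [MeasurableSpace Ω]
    (P : Measure Ω) [IsProbabilityMeasure P] {W₁ W₂ : Ω → ℝ}
    (h₁ : Measurable W₁) (h₂ : Measurable W₂) :
    Integrable (fun z : Ω × ℝ ↦ (((if W₁ z.1 ≤ z.2 then (1 : ℝ) else 0)
      + (if W₂ z.1 ≤ z.2 then (1 : ℝ) else 0)) / 2 - z.2) ^ 2)
      (P.prod (volume.restrict (Set.Icc (0 : ℝ) 1))) := by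
  have hm {W : Ω → ℝ} (hW : Measurable W) :
      Measurable (fun z : Ω × ℝ ↦ if W z.1 ≤ z.2 then (1 : ℝ) else 0) :=
    Measurable.ite (measurableSet_le (hW.comp measurable_fst) measurable_snd)
      measurable_const measurable_const
  refine Integrable.of_bound
    ((((hm h₁).add (hm h₂)).div_const 2).sub measurable_snd |>.pow_const 2).aestronglyMeasurable
    1 ?_
  have hae : ∀ᵐ x ∂(volume.restrict (Set.Icc (0 : ℝ) 1)), x ∈ Set.Icc (0 : ℝ) 1 :=
    ae_restrict_mem measurableSet_Icc
  filter_upwards [Measure.quasiMeasurePreserving_snd.ae hae] with z hz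
  rw [Real.norm_eq_abs, abs_of_nonneg (sq_nonneg _)]
  obtain ⟨hz₀, hz₁⟩ := hz
  split_ifs <;> nlinarith

/-- The distribution function of the uniform law on `[a,b]`. -/
lemma measureReal_le_of_map_eq_cond_Icc {Ω : Type*} [MeasurableSpace Ω]
    {P : Measure Ω} {X : Ω → ℝ} (hX : Measurable X) {a b : ℝ} (hab : a ≤ b)
    (hlaw : Measure.map X P = ProbabilityTheory.cond volume (Set.Icc a b)) (x : ℝ) :
    P.real {ω | X ω ≤ x} = max (min b x - a) 0 / (b - a) := by
  have : P {ω | X ω ≤ x} = Measure.map X P (Set.Iic x) :=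
    (Measure.map_apply hX measurableSet_Iic).symm
  rw [measureReal_def, this, hlaw, cond_apply measurableSet_Icc]
  have hset : Set.Icc a b ∩ Set.Iic x = Set.Icc a (min b x) := by
    ext y
    simp [and_assoc]
  rw [hset, Real.volume_Icc, Real.volume_Icc, ENNReal.toReal_mul, ENNReal.toReal_inv,
    ENNReal.toReal_ofReal (sub_nonneg.2 hab), ENNReal.toReal_ofReal', div_eq_inv_mul]

/-- If `X₁, X₂` are independent, uniform on `[0,1/2]` and on `[1/2,1]` respectively, and
`Y₁, Y₂` are independent `[0,1]`-valued random variables whose cumulative distribution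
functions satisfy `(F_{Y₁}(x) + F_{Y₂}(x))/2 = x` on `[0,1]`, then
`E L2²({Y₁,Y₂}) ≥ E L2²({X₁,X₂})`. -/
theorem meanL2sqPair_ge_of_cdf_avg {Ω : Type*} [MeasurableSpace Ω]
    (P : Measure Ω) [IsProbabilityMeasure P]
    (X₁ X₂ Y₁ Y₂ : Ω → ℝ)
    (hX₁m : Measurable X₁) (hX₂m : Measurable X₂)
    (hY₁m : Measurable Y₁) (hY₂m : Measurable Y₂)
    (hXindep : IndepFun X₁ X₂ P)
    (hX₁law : Measure.map X₁ P = ProbabilityTheory.cond volume (Set.Icc (0 : ℝ) (1 / 2)))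
    (hX₂law : Measure.map X₂ P = ProbabilityTheory.cond volume (Set.Icc (1 / 2 : ℝ) 1))
    (hYindep : IndepFun Y₁ Y₂ P)
    (hY₁range : ∀ ω, Y₁ ω ∈ Set.Icc (0 : ℝ) 1)
    (hY₂range : ∀ ω, Y₂ ω ∈ Set.Icc (0 : ℝ) 1)
    (hcdf : ∀ x ∈ Set.Icc (0 : ℝ) 1,
      ((P {ω | Y₁ ω ≤ x}).toReal + (P {ω | Y₂ ω ≤ x}).toReal) / 2 = x) :
    meanL2sqPair P X₁ X₂ ≤ meanL2sqPair P Y₁ Y₂ := by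
  have iX := integrable_sq_localDiscrepancy P hX₁m hX₂m
  have iY := integrable_sq_localDiscrepancy P hY₁m hY₂m
  unfold meanL2sqPair
  refine (integral_integral_swap iX).trans_le (le_of_le_of_eq ?_ (integral_integral_swap iY).symm)
  refine setIntegral_mono_on iX.integral_prod_right iY.integral_prod_right measurableSet_Icc ?_
  intro x hx
  rw [integral_sq_localDiscrepancy hX₁m hX₂m hXindep,
    integral_sq_localDiscrepancy hY₁m hY₂m hYindep,
    measureReal_le_of_map_eq_cond_Icc hX₁m (by norm_num) hX₁law,
    measureReal_le_of_map_eq_cond_Icc hX₂m (by norm_num) hX₂law]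
  have hsum : (P.real {ω | Y₁ ω ≤ x} + P.real {ω | Y₂ ω ≤ x}) / 2 = x := hcdf x hx
  have a₀ : 0 ≤ P.real {ω | Y₁ ω ≤ x} := measureReal_nonneg
  have b₀ : 0 ≤ P.real {ω | Y₂ ω ≤ x} := measureReal_nonneg
  have a₁ : P.real {ω | Y₁ ω ≤ x} ≤ 1 := measureReal_le_one
  have b₁ : P.real {ω | Y₂ ω ≤ x} ≤ 1 := measureReal_le_one
  generalize P.real {ω | Y₁ ω ≤ x} = a at *
  generalize P.real {ω | Y₂ ω ≤ x} = b at *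
  obtain ⟨hx₀, hx₁⟩ := hx
  have hab : a + b = 2 * x := by linarith
  have hab₀ : 0 ≤ a * b := mul_nonneg a₀ b₀
  have hab₁ : 2 * x - 1 ≤ a * b := by nlinarith [mul_nonneg (sub_nonneg.2 a₁) (sub_nonneg.2 b₁)]
  rw [hab]
  rcases le_total x (1 / 2) with h | h
  · rw [min_eq_right h, min_eq_right hx₁, max_eq_left (by linarith), max_eq_right (by linarith),
      zero_div, show (x - 0) / (1 / 2 - 0) = 2 * x by ring]
    linarith
  · rw [min_eq_left h, min_eq_right hx₁, max_eq_left (by norm_num), max_eq_left (by linarith)]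
    norm_num
    linarith
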